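/- The group algebra ℂ[ℤ/2ℤ ∗ ℤ/3ℤ] of the free product of the cyclic groups of orders 2 and 3 (that is, the modular group algebra ℂ PSL₂(ℤ)) has the lifting property with respect to nilpotent ideals: for every associative unital ℂ-algebra B, every two-sided ideal I of B with I^k = 0 for some k ≥ 1, and every ℂ-algebra homomorphism φ : ℂ[ℤ/2ℤ ∗ ℤ/3ℤ] → B/I, there exists a ℂ-algebra homomorphism φ̃ : ℂ[ℤ/2ℤ ∗ ℤ/3ℤ] → B with π ∘ φ̃ = φ. -/

import Mathlib

/-- The quotient of a `ℂ`-algebra by (the ring congruence associated to) a two-sided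
ideal is again a `ℂ`-algebra. -/
noncomputable instance ringConQuotientAlgebra {B : Type*} [Ring B] [Algebra ℂ B]
    (c : RingCon B) : Algebra ℂ c.Quotient :=
  RingHom.toAlgebra' ((RingCon.mk' c).comp (algebraMap ℂ B)) (by
    intro r x
    induction x using Quotient.ind' with
    | _ b =>
      show ((algebraMap ℂ B r : B) : c.Quotient) * (b : c.Quotient)
          = (b : c.Quotient) * ((algebraMap ℂ B r : B) : c.Quotient)
      rw [← RingCon.coe_mul, ← RingCon.coe_mul, Algebra.commutes])

/-- The quotient map `π : B → B/I` as a `ℂ`-algebra homomorphism. -/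
noncomputable def quotAlgHom {B : Type*} [Ring B] [Algebra ℂ B] (I : TwoSidedIdeal B) :
    B →ₐ[ℂ] I.ringCon.Quotient :=
  { RingCon.mk' I.ringCon with commutes' := fun _ => rfl }

/-- A two-sided ideal `I` is nilpotent if `I ^ k = 0` for some `k ≥ 1`, i.e. every
(ordered) product of `k` elements of `I` vanishes. -/
def IsNilpotentTwoSidedIdeal {B : Type*} [Ring B] (I : TwoSidedIdeal B) : Prop :=
  ∃ k : ℕ, 1 ≤ k ∧ ∀ f : Fin k → B, (∀ i, f i ∈ I) → (List.ofFn f).prod = 0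

/-- `A` has the lifting property with respect to nilpotent ideals (formal smoothness in
the sense of Cuntz–Quillen): every `ℂ`-algebra map `φ : A → B/I`, with `I` a nilpotent
two-sided ideal of a `ℂ`-algebra `B`, lifts to a `ℂ`-algebra map `φ̃ : A → B` with
`π ∘ φ̃ = φ`. -/
def HasNilpotentLiftingProperty (A : Type*) [Ring A] [Algebra ℂ A] : Prop :=
  ∀ (B : Type) [Ring B] [Algebra ℂ B] (I : TwoSidedIdeal B),
    IsNilpotentTwoSidedIdeal I →
      ∀ φ : A →ₐ[ℂ] I.ringCon.Quotient,
        ∃ φtilde : A →ₐ[ℂ] B, (quotAlgHom I).comp φtilde = φ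

open Polynomial in
/-- The universal case of Newton lifting: modulo `P ^ m` the separable polynomial `P` has a root
which agrees with `X` modulo `P`. -/
theorem Polynomial.Separable.exists_pow_dvd_comp_and_dvd_sub_X {K : Type*} [Field K] {P : K[X]}
    (hP : P.Separable) {m : ℕ} (hm : m ≠ 0) :
    ∃ q : K[X], P ^ m ∣ P.comp q ∧ P ∣ q - X := by
  let J : Ideal K[X] := Ideal.span {P ^ m}
  have aeval_mk (r q : K[X]) :
      aeval (Ideal.Quotient.mk J q) r = Ideal.Quotient.mk J (r.comp q) := by
    rw [← Ideal.Quotient.mkₐ_eq_mk K, aeval_algHom_apply, comp_eq_aeval]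
  have hnil : IsNilpotent (aeval (Ideal.Quotient.mk J X) P) := by
    refine ⟨m, ?_⟩
    rw [aeval_mk, comp_X, ← map_pow]
    exact Ideal.Quotient.eq_zero_iff_mem.2 (Ideal.mem_span_singleton_self _)
  have hunit : IsUnit (aeval (Ideal.Quotient.mk J X) (derivative P)) := by
    rw [aeval_mk, comp_X]
    obtain ⟨a, b, hab⟩ := (IsCoprime.pow_left hP : IsCoprime (P ^ m) (derivative P))
    refine IsUnit.of_mul_eq_one_right (Ideal.Quotient.mk J b) ?_
    rw [← map_mul, ← map_one (Ideal.Quotient.mk J), Ideal.Quotient.eq,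
      Ideal.mem_span_singleton]
    exact ⟨-a, by linear_combination hab⟩
  obtain ⟨y, ⟨⟨k, hk⟩, hy⟩, -⟩ := existsUnique_nilpotent_sub_and_aeval_eq_zero hnil hunit
  obtain ⟨q, rfl⟩ := Ideal.Quotient.mk_surjective y
  refine ⟨q, ?_, ?_⟩
  · rwa [aeval_mk, Ideal.Quotient.eq_zero_iff_mem, Ideal.mem_span_singleton] at hy
  · rw [← map_sub, ← map_pow, Ideal.Quotient.eq_zero_iff_mem, Ideal.mem_span_singleton] at hk
    have hdvd : P ∣ (X - q) ^ (k + 1) :=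
      ((dvd_pow_self P hm).trans hk).trans (pow_dvd_pow _ k.le_succ)
    rw [dvd_sub_comm]
    exact (hP.squarefree.dvd_pow_iff_dvd k.succ_ne_zero).1 hdvd

open Polynomial in
/-- Roots of separable polynomials lift along surjections with nil kernel, also between
noncommutative algebras. -/
theorem Polynomial.Separable.exists_aeval_eq_zero_of_ker_isNilpotent {K R S : Type*} [Field K]
    [Ring R] [Ring S] [Algebra K R] [Algebra K S] {P : K[X]} (hP : P.Separable) (f : R →ₐ[K] S)
    (hf : Function.Surjective f) (hnil : ∀ x, f x = 0 → IsNilpotent x) {s : S}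
    (hs : aeval s P = 0) : ∃ r : R, aeval r P = 0 ∧ f r = s := by
  obtain ⟨x, rfl⟩ := hf s
  obtain ⟨m, hm⟩ := hnil (aeval x P) (by rw [← aeval_algHom_apply, hs])
  obtain ⟨q, ⟨a, ha⟩, ⟨b, hb⟩⟩ := hP.exists_pow_dvd_comp_and_dvd_sub_X m.succ_ne_zero
  refine ⟨aeval x q, ?_, ?_⟩
  · rw [← aeval_comp, ha, map_mul, map_pow, pow_succ, hm, zero_mul, zero_mul]
  · rw [← aeval_algHom_apply, ← sub_eq_zero]
    simpa [hs] using congrArg (aeval (f x)) hb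

/-- The homomorphism out of the cyclic group of order `n` determined by an `n`-th root of unity. -/
def zmodPowersHom {M : Type*} [Monoid M] (n : ℕ) [NeZero n] (y : M) (hy : y ^ n = 1) :
    Multiplicative (ZMod n) →* M where
  toFun x := y ^ x.toAdd.val
  map_one' := by simp
  map_mul' a b := by
    rw [toAdd_mul, ZMod.val_add, ← pow_eq_pow_mod _ hy, pow_add]

open Polynomial in
/-- Homomorphisms from a finite cyclic group to the multiplicative monoid of an algebra lift along
surjections with nil kernel, provided that the order of the group is invertible. -/
theorem exists_monoidHom_zmod_lift_of_ker_isNilpotent {K R S : Type*} [Field K] [Ring R] [Ring S]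
    [Algebra K R] [Algebra K S] (f : R →ₐ[K] S) (hf : Function.Surjective f)
    (hnil : ∀ x, f x = 0 → IsNilpotent x) (n : ℕ) [NeZero n] (hn : (n : K) ≠ 0)
    (g : Multiplicative (ZMod n) →* S) :
    ∃ h : Multiplicative (ZMod n) →* R, (f : R →* S).comp h = g := by
  have hg : g (.ofAdd 1) ^ n = 1 := by
    rw [← map_pow, ← ofAdd_nsmul, nsmul_one, ZMod.natCast_self, ofAdd_zero, map_one]
  obtain ⟨y, hy, hfy⟩ :=
    (X_pow_sub_one_separable_iff.2 hn).exists_aeval_eq_zero_of_ker_isNilpotent f hf hnil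
      (s := g (.ofAdd 1)) (by simp [hg])
  refine ⟨zmodPowersHom n y (by simpa [sub_eq_zero] using hy), MonoidHom.ext fun x ↦ ?_⟩
  change f (y ^ x.toAdd.val) = g x
  rw [map_pow, hfy, ← map_pow, ← ofAdd_nsmul, nsmul_one, ZMod.natCast_zmod_val, ofAdd_toAdd]

theorem quotAlgHom_surjective {B : Type*} [Ring B] [Algebra ℂ B] (I : TwoSidedIdeal B) :
    Function.Surjective (quotAlgHom I) :=
  RingCon.mk'_surjective _

theorem IsNilpotentTwoSidedIdeal.isNilpotent_of_quotAlgHom_eq_zero {B : Type*} [Ring B]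
    [Algebra ℂ B] {I : TwoSidedIdeal B} (hI : IsNilpotentTwoSidedIdeal I) {x : B}
    (hx : quotAlgHom I x = 0) : IsNilpotent x := by
  obtain ⟨k, -, hk⟩ := hI
  have hxI : x ∈ I := (TwoSidedIdeal.mem_iff I x).2 ((RingCon.eq _).1 hx)
  exact ⟨k, by simpa using hk (fun _ ↦ x) fun _ ↦ hxI⟩

/-- The group algebra `ℂ[ℤ/2ℤ ∗ ℤ/3ℤ]` of the free product of the
cyclic groups of orders `2` and `3` — that is, the modular group algebra
`ℂ PSL₂(ℤ)` — has the lifting property with respect to nilpotent ideals: it is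
formally smooth in the sense of Cuntz–Quillen. -/
theorem modularGroupAlgebra_hasNilpotentLiftingProperty :
    HasNilpotentLiftingProperty
      (MonoidAlgebra ℂ
        (Monoid.Coprod (Multiplicative (ZMod 2)) (Multiplicative (ZMod 3)))) := by
  intro B _ _ I hI φ
  have lift (n : ℕ) [NeZero n] (g : Multiplicative (ZMod n) →* I.ringCon.Quotient) :
      ∃ h : Multiplicative (ZMod n) →* B, (quotAlgHom I : B →* _).comp h = g :=
    exists_monoidHom_zmod_lift_of_ker_isNilpotent (quotAlgHom I) (quotAlgHom_surjective I)
      (fun _ ↦ hI.isNilpotent_of_quotAlgHom_eq_zero) n (NeZero.ne _) g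
  let ψ := (MonoidAlgebra.lift ℂ _ _).symm φ
  obtain ⟨h₂, hh₂⟩ := lift 2 (ψ.comp Monoid.Coprod.inl)
  obtain ⟨h₃, hh₃⟩ := lift 3 (ψ.comp Monoid.Coprod.inr)
  have hψ : (quotAlgHom I : B →* _).comp (Monoid.Coprod.lift h₂ h₃) = ψ := by
    rw [Monoid.Coprod.comp_lift, hh₂, hh₃]
    exact (Monoid.Coprod.lift_unique rfl rfl).symm
  refine ⟨MonoidAlgebra.lift ℂ B _ (Monoid.Coprod.lift h₂ h₃), ?_⟩
  refine MonoidAlgebra.algHom_ext (fun m ↦ ?_) (Subsingleton.elim _ _)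
  simpa [ψ] using DFunLike.congr_fun hψ m
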